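/- Let 𝔄 be a C*-algebra and let T : 𝔄 → 𝔄 be a positive linear contraction (i.e. T maps positive elements to positive elements and ‖T‖ ≤ 1). Let 𝒟₁ denote the set of all positive continuous linear functionals ν on 𝔄 for which there exists a sequence (νₙ)_{n≥0} of positive continuous linear functionals on 𝔄 with ν₀ = ν, ‖νₙ‖ ≤ 1 for all n ≥ 0, and T*ν_{n+1} = νₙ for all n ≥ 0 (where T*ω = ω ∘ T). Then for every positive element x ∈ 𝔄, the limit lim_{n→∞} ‖Tⁿ x‖ exists and equals sup { |ν(x)| : ν ∈ 𝒟₁ }. -/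

import Mathlib

open Filter Topology
open scoped ComplexOrder

section PositiveFunctionals

variable {A : Type*} [NonUnitalCStarAlgebra A]

/-- In a C⋆-algebra, a self-adjoint element lying between `-r` and `r` has norm at most `r`. -/
theorem IsSelfAdjoint.norm_le_of_mem_Icc_algebraMap {B : Type*} [CStarAlgebra B] [PartialOrder B]
    [StarOrderedRing B] {c : B} (hc : IsSelfAdjoint c) {r : ℝ} (hr : 0 ≤ r)
    (h₁ : algebraMap ℝ B (-r) ≤ c) (h₂ : c ≤ algebraMap ℝ B r) : ‖c‖ ≤ r := by
  obtain h | h := subsingleton_or_nontrivial B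
  · simpa [Subsingleton.elim c 0] using hr
  rw [algebraMap_le_iff_le_spectrum] at h₁
  rw [le_algebraMap_iff_spectrum_le] at h₂
  rcases CStarAlgebra.norm_or_neg_norm_mem_spectrum hc with h | h
  · exact h₂ _ h
  · linarith [h₁ _ h]

/-- The difference of two positive elements of norm at most `r` has norm at most `r`. -/
theorem CStarAlgebra.norm_sub_le_of_nonneg [PartialOrder A] [StarOrderedRing A] {a b : A} {r : ℝ}
    (ha : 0 ≤ a) (hb : 0 ≤ b) (har : ‖a‖ ≤ r) (hbr : ‖b‖ ≤ r) : ‖a - b‖ ≤ r := by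
  have hr : 0 ≤ r := (norm_nonneg a).trans har
  have ha' : (0 : Unitization ℂ A) ≤ a := Unitization.inr_nonneg_iff.mpr ha
  have hb' : (0 : Unitization ℂ A) ≤ b := Unitization.inr_nonneg_iff.mpr hb
  have har' := (CStarAlgebra.norm_le_iff_le_algebraMap (a : Unitization ℂ A) hr ha').mp
    (by simpa [Unitization.norm_inr] using har)
  have hbr' := (CStarAlgebra.norm_le_iff_le_algebraMap (b : Unitization ℂ A) hr hb').mp
    (by simpa [Unitization.norm_inr] using hbr)
  rw [← Unitization.norm_inr (𝕜 := ℂ), Unitization.inr_sub]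
  refine ((IsSelfAdjoint.of_nonneg ha').sub (.of_nonneg hb')).norm_le_of_mem_Icc_algebraMap hr
    ?_ ((sub_le_self _ hb').trans har')
  rw [map_neg]
  exact (neg_le_neg hbr').trans (by simpa [sub_eq_add_neg] using ha')

/-- Replacing a functional by its hermitian part: if `f a` is real for a self-adjoint `a`, some
functional of no larger norm agrees with `f` at `a` and is real on self-adjoint elements. -/
theorem exists_hermitian_functional (f : StrongDual ℂ A) {a : A} (ha : IsSelfAdjoint a)
    (hfa : (f a).im = 0) :
    ∃ g : StrongDual ℂ A, ‖g‖ ≤ ‖f‖ ∧ g a = f a ∧ ∀ b, IsSelfAdjoint b → (g b).im = 0 := by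
  let l : A →ₗ[ℂ] ℂ :=
    { toFun := fun x => (f x + star (f (star x))) / 2
      map_add' := fun x y => by simp only [star_add, map_add]; ring
      map_smul' := fun c x => by
        simp only [star_smul, map_smul, smul_eq_mul, star_mul', star_star, RingHom.id_apply]
        ring }
  refine ⟨l.mkContinuous ‖f‖ fun x => ?_, l.mkContinuous_norm_le (norm_nonneg f) _, ?_, ?_⟩
  · have h₁ := f.le_opNorm x
    have h₂ := f.le_opNorm (star x)
    rw [norm_star] at h₂
    have h₃ := norm_add_le (f x) (star (f (star x)))
    rw [norm_star] at h₃
    change ‖(f x + star (f (star x))) / 2‖ ≤ _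
    rw [norm_div, Complex.norm_ofNat]
    linarith
  · change (f a + star (f (star a))) / 2 = f a
    rw [ha.star_eq]
    apply Complex.ext <;> simp [hfa]
  · intro b hb
    change ((f b + star (f (star b))) / 2).im = 0
    rw [hb.star_eq]
    simp

/-- Every positive element of a C⋆-algebra is normed by a positive functional of norm at most
one. -/
theorem exists_positive_functional_apply_eq_norm [PartialOrder A] [StarOrderedRing A] {a : A}
    (ha : 0 ≤ a) :
    ∃ g : StrongDual ℂ A, (∀ y, 0 ≤ y → 0 ≤ g y) ∧ ‖g‖ ≤ 1 ∧ g a = ‖a‖ := by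
  obtain rfl | ha0 := eq_or_ne a 0
  · exact ⟨0, by simp, by simp, by simp⟩
  obtain ⟨f, hf, hfa⟩ := exists_dual_vector'' ℂ a
  obtain ⟨g, hg, hga, hgr⟩ := exists_hermitian_functional f (.of_nonneg ha) (by simp [hfa])
  replace hga : g a = ‖a‖ := hga.trans hfa
  refine ⟨g, fun y hy => ?_, hg.trans hf, hga⟩
  have him := hgr y (.of_nonneg hy)
  refine Complex.nonneg_iff.mpr ⟨?_, him.symm⟩
  obtain rfl | hy0 := eq_or_ne y 0
  · simp
  have hna : 0 < ‖a‖ := norm_pos_iff.mpr ha0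
  have hny : 0 < ‖y‖ := norm_pos_iff.mpr hy0
  have hz : (0 : A) ≤ ((‖a‖ / ‖y‖ : ℝ) : ℂ) • y :=
    smul_nonneg (by exact_mod_cast (by positivity : 0 ≤ ‖a‖ / ‖y‖)) hy
  have hzn : ‖((‖a‖ / ‖y‖ : ℝ) : ℂ) • y‖ ≤ ‖a‖ := by
    rw [norm_smul, Complex.norm_real, Real.norm_of_nonneg (by positivity)]
    exact (div_mul_cancel₀ _ hny.ne').le
  have h := (Complex.re_le_norm _).trans ((g.le_of_opNorm_le (hg.trans hf) _).trans
    ((one_mul _).le.trans (CStarAlgebra.norm_sub_le_of_nonneg ha hz le_rfl hzn)))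
  rw [map_sub, map_smul, hga, Complex.sub_re, Complex.ofReal_re, smul_eq_mul,
    Complex.re_ofReal_mul] at h
  have h' : 0 ≤ ‖a‖ / ‖y‖ * (g y).re := by linarith
  exact nonneg_of_mul_nonneg_right h' (by positivity)

end PositiveFunctionals

/-- Banach–Alaoglu along an ultrafilter: a family in the dual unit ball has a pointwise limit in the
dual unit ball. -/
theorem Ultrafilter.exists_tendsto_apply_of_norm_le_one {ι E : Type*} [SeminormedAddCommGroup E]
    [NormedSpace ℂ E] (U : Ultrafilter ι) (f : ι → StrongDual ℂ E) (hf : ∀ i, ‖f i‖ ≤ 1) :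
    ∃ g : StrongDual ℂ E, ‖g‖ ≤ 1 ∧ ∀ y, Tendsto (fun i => f i y) U (𝓝 (g y)) := by
  let F : ι → WeakDual ℂ E := fun i => StrongDual.toWeakDual (f i)
  obtain ⟨g, hg, hlim⟩ := (WeakDual.isCompact_closedBall (0 : StrongDual ℂ E) 1).ultrafilter_le_nhds
    (U.map F) (le_principal_iff.mpr (mem_map.mpr (univ_mem' fun i => by simpa [F] using hf i)))
  exact ⟨WeakDual.toStrongDual g, by simpa using hg,
    fun y => ((WeakDual.eval_continuous y).tendsto g).comp hlim⟩

theorem exists_backward_orbit_apply_eq {A : Type*} [NonUnitalCStarAlgebra A] [PartialOrder A]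
    [StarOrderedRing A] (T : A →L[ℂ] A) (hTpos : ∀ x : A, 0 ≤ x → 0 ≤ T x) (hTnorm : ‖T‖ ≤ 1)
    {x : A} (hx : 0 ≤ x) {L : ℝ} (hL : Tendsto (fun n : ℕ => ‖(T ^ n) x‖) atTop (𝓝 L)) :
    ∃ ν : ℕ → (A →L[ℂ] ℂ), (∀ n, ∀ y : A, 0 ≤ y → 0 ≤ ν n y) ∧ (∀ n, ‖ν n‖ ≤ 1) ∧
      (∀ n, (ν (n + 1)).comp T = ν n) ∧ ν 0 x = L := by
  have hpos : ∀ (n : ℕ) (y : A), 0 ≤ y → 0 ≤ (T ^ n) y := by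
    intro n
    induction n with
    | zero => intro y hy; simpa using hy
    | succ n ih => intro y hy; rw [pow_succ]; exact ih _ (hTpos y hy)
  have hpow (n : ℕ) : ‖T ^ n‖ ≤ 1 := by
    induction n with
    | zero => exact ContinuousLinearMap.norm_id_le
    | succ n ih =>
      rw [pow_succ]
      exact (norm_mul_le _ _).trans (mul_le_one₀ ih (norm_nonneg _) hTnorm)
  choose ω hωpos hωnorm hωx using fun n => exists_positive_functional_apply_eq_norm (hpos n x hx)
  let U : Ultrafilter ℕ := Ultrafilter.of atTop
  have hU : (U : Filter ℕ) ≤ atTop := Ultrafilter.of_le atTop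
  choose ν hνnorm hνlim using fun k => U.exists_tendsto_apply_of_norm_le_one
    (fun n => (ω n).comp (T ^ (n - k))) fun n =>
      ((ω n).opNorm_comp_le _).trans (mul_le_one₀ (hωnorm n) (norm_nonneg _) (hpow _))
  refine ⟨ν, fun k y hy => ?_, hνnorm, fun k => ?_, ?_⟩
  · exact ge_of_tendsto' (hνlim k y) fun n => hωpos n _ (hpos _ y hy)
  · ext y
    refine tendsto_nhds_unique (hνlim (k + 1) (T y)) ((hνlim k y).congr' ?_)
    filter_upwards [hU (eventually_ge_atTop (k + 1))] with n hn
    rw [show n - k = n - (k + 1) + 1 by omega, pow_succ]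
    rfl
  · refine tendsto_nhds_unique (hνlim 0 x) ?_
    have h := ((Complex.continuous_ofReal.tendsto L).comp hL).mono_left hU
    refine h.congr fun n => ?_
    exact (hωx n).symm

theorem limit_of_norms_of_iterates_eq_sup
    {A : Type*} [NonUnitalNormedRing A] [StarRing A] [CStarRing A]
    [PartialOrder A] [StarOrderedRing A] [CompleteSpace A]
    [NormedSpace ℂ A] [IsScalarTower ℂ A A] [SMulCommClass ℂ A A] [StarModule ℂ A]
    (T : A →L[ℂ] A)
    (hTpos : ∀ x : A, 0 ≤ x → 0 ≤ T x) (hTnorm : ‖T‖ ≤ 1)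
    (x : A) (hx : 0 ≤ x) :
    Tendsto (fun n : ℕ => ‖(T ^ n) x‖) atTop
      (𝓝 (sSup { r : ℝ | ∃ ν : ℕ → (A →L[ℂ] ℂ),
        (∀ n, ∀ y : A, 0 ≤ y → 0 ≤ ν n y) ∧
        (∀ n, ‖ν n‖ ≤ 1) ∧
        (∀ n, (ν (n + 1)).comp T = ν n) ∧
        r = ‖ν 0 x‖ })) := by
  let _ : NonUnitalCStarAlgebra A := {}
  have hanti : Antitone fun n : ℕ => ‖(T ^ n) x‖ := antitone_nat_of_succ_le fun n => by
    rw [pow_succ']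
    exact (T.le_of_opNorm_le hTnorm _).trans (one_mul _).le
  have hL := tendsto_atTop_ciInf hanti ⟨0, by rintro _ ⟨n, rfl⟩; exact norm_nonneg _⟩
  set L := ⨅ n : ℕ, ‖(T ^ n) x‖
  have hL0 : 0 ≤ L := ge_of_tendsto' hL fun n => norm_nonneg _
  obtain ⟨ν, h₁, h₂, h₃, h₄⟩ := exists_backward_orbit_apply_eq T hTpos hTnorm hx hL
  convert hL
  refine IsGreatest.csSup_eq ⟨⟨ν, h₁, h₂, h₃, ?_⟩, ?_⟩
  · rw [h₄, Complex.norm_real, Real.norm_of_nonneg hL0]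
  · rintro _ ⟨μ, -, hμnorm, hμT, rfl⟩
    have hμ : ∀ n : ℕ, μ 0 x = μ n ((T ^ n) x) := by
      intro n
      induction n with
      | zero => simp
      | succ n ih => rw [ih, ← hμT n, pow_succ']; rfl
    refine ge_of_tendsto' hL fun n => ?_
    rw [hμ n]
    exact ((μ n).le_of_opNorm_le (hμnorm n) _).trans (one_mul _).le
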